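/- Let l ∈ {1, 2} and ρ > 0. If g : (0,∞) → ℂ is four times differentiable, satisfies (T_l^2 g)(r) = i ρ^4 g(r) for all r > 0, and is square integrable on (0,∞), then there is a complex constant c such that g = c · g_{l+}, where g_{l+}(r) = D_l( exp(e^{i 5π/8} ρ r) - exp(e^{i 9π/8} ρ r) ). In particular the space of square-integrable solutions is one-dimensional, so the symmetric operator T_l^2 has deficiency indices (1,1) for l = 1, 2. -/

import Mathlib

open Set MeasureTheory

/-- The `l`-th order differential operation
`(D_l w)(r) = r^(l+1) ((1/r) d/dr)^l (w(r)/r)` on `(0,∞)`. -/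
noncomputable def Dop (l : ℕ) (w : ℝ → ℂ) : ℝ → ℂ :=
  fun r => (r : ℂ) ^ (l + 1) *
    ((fun f : ℝ → ℂ => fun s : ℝ => ((s : ℂ))⁻¹ * deriv f s)^[l]
      (fun s : ℝ => w s / (s : ℂ))) r

/-- The second-order differential operation
`(T_l u)(r) = -u''(r) + l(l+1) u(r)/r^2` on `(0,∞)`. -/
noncomputable def Tl (l : ℕ) (u : ℝ → ℂ) : ℝ → ℂ :=
  fun r => -(deriv (deriv u) r) + ((l : ℂ) * ((l : ℂ) + 1)) * u r / (r : ℂ) ^ 2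

/-- The deficiency element
`g_{l+} = D_l(exp(e^{i5π/8} ρ r) - exp(e^{i9π/8} ρ r))`. -/
noncomputable def gPlus (l : ℕ) (ρ : ℝ) : ℝ → ℂ :=
  Dop l (fun r =>
    Complex.exp (Complex.exp (Complex.I * (5 * Real.pi / 8)) * ρ * r)
      - Complex.exp (Complex.exp (Complex.I * (9 * Real.pi / 8)) * ρ * r))

open Filter Topology

/-- The factor multiplying the exponential in `D_l (exp (κ r))`, as a polynomial in `x = 1 / r`. -/
def expSolCoeff (l : ℕ) (κ : ℂ) (x : ℂ) : ℂ :=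
  if l = 1 then κ - x else κ ^ 2 - 3 * κ * x + 3 * x ^ 2

/-- The solution `D_l (exp (κ r))` of `T_l u = -κ ^ 2 u`, for `l` equal to 1 or 2. -/
noncomputable def expSol (l : ℕ) (κ : ℂ) (r : ℝ) : ℂ :=
  Complex.exp (κ * r) * expSolCoeff l κ (r : ℂ)⁻¹

/-- The derivative of `expSol l κ`. -/
noncomputable def expSolDeriv (l : ℕ) (κ : ℂ) (r : ℝ) : ℂ :=
  Complex.exp (κ * r) * if l = 1 then κ ^ 2 - κ * (r : ℂ)⁻¹ + (r : ℂ)⁻¹ ^ 2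
    else κ ^ 3 - 3 * κ ^ 2 * (r : ℂ)⁻¹ + 6 * κ * (r : ℂ)⁻¹ ^ 2 - 6 * (r : ℂ)⁻¹ ^ 3

theorem hasDerivAt_cexp_mul_ofReal (κ : ℂ) (r : ℝ) :
    HasDerivAt (fun s : ℝ => Complex.exp (κ * s)) (κ * Complex.exp (κ * r)) r := by
  have h := ((hasDerivAt_id (r : ℂ)).const_mul κ).cexp.comp_ofReal
  simpa [mul_comm] using h

theorem hasDerivAt_ofReal_inv {r : ℝ} (hr : r ≠ 0) :
    HasDerivAt (fun s : ℝ => (s : ℂ)⁻¹) (-(r : ℂ)⁻¹ ^ 2) r := by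
  simpa using (hasDerivAt_inv (Complex.ofReal_ne_zero.2 hr)).comp_ofReal

theorem hasDerivAt_expSol {l : ℕ} (hl : l = 1 ∨ l = 2) (κ : ℂ) {r : ℝ} (hr : r ≠ 0) :
    HasDerivAt (expSol l κ) (expSolDeriv l κ r) r := by
  have he := hasDerivAt_cexp_mul_ofReal κ r
  have hi := hasDerivAt_ofReal_inv hr
  rcases hl with rfl | rfl
  · refine (he.mul (hi.const_sub κ)).congr_deriv ?_ |>.congr_of_eventuallyEq (.of_forall fun s => ?_)
    · simp [expSolDeriv]; ring
    · simp [expSol, expSolCoeff]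
  · refine (he.mul (((hi.const_mul (3 * κ)).const_sub (κ ^ 2)).add
      ((hi.pow 2).const_mul 3))).congr_deriv ?_ |>.congr_of_eventuallyEq (.of_forall fun s => ?_)
    · simp [expSolDeriv]; ring
    · simp [expSol, expSolCoeff]

theorem hasDerivAt_expSolDeriv {l : ℕ} (hl : l = 1 ∨ l = 2) (κ : ℂ) {r : ℝ} (hr : r ≠ 0) :
    HasDerivAt (expSolDeriv l κ) ((l * (l + 1) / (r : ℂ) ^ 2 + κ ^ 2) * expSol l κ r) r := by
  have he := hasDerivAt_cexp_mul_ofReal κ r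
  have hi := hasDerivAt_ofReal_inv hr
  rcases hl with rfl | rfl
  · refine (he.mul (((hi.const_mul κ).const_sub (κ ^ 2)).add
      (hi.pow 2))).congr_deriv ?_ |>.congr_of_eventuallyEq (.of_forall fun s => ?_)
    · simp [expSol, expSolCoeff]; ring
    · simp [expSolDeriv]
  · refine (he.mul ((((hi.const_mul (3 * κ ^ 2)).const_sub (κ ^ 3)).add
      ((hi.pow 2).const_mul (6 * κ))).sub ((hi.pow 3).const_mul 6))).congr_deriv ?_
      |>.congr_of_eventuallyEq (.of_forall fun s => ?_)
    · simp [expSol, expSolCoeff]; ring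
    · simp [expSolDeriv]

theorem wronskian_const {q u u' v v' : ℝ → ℂ}
    (hu : ∀ r ∈ Ioi (0 : ℝ), HasDerivAt u (u' r) r)
    (hu' : ∀ r ∈ Ioi (0 : ℝ), HasDerivAt u' (q r * u r) r)
    (hv : ∀ r ∈ Ioi (0 : ℝ), HasDerivAt v (v' r) r)
    (hv' : ∀ r ∈ Ioi (0 : ℝ), HasDerivAt v' (q r * v r) r) :
    ∃ c : ℂ, ∀ r ∈ Ioi (0 : ℝ), u r * v' r - u' r * v r = c := by
  have hd : ∀ r ∈ Ioi (0 : ℝ), HasDerivAt (fun s => u s * v' s - u' s * v s) 0 r := by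
    intro r hr
    refine (((hu r hr).mul (hv' r hr)).sub ((hu' r hr).mul (hv r hr))).congr_deriv ?_
    ring
  exact isOpen_Ioi.exists_is_const_of_deriv_eq_zero isPreconnected_Ioi
    (fun r hr => (hd r hr).differentiableAt.differentiableWithinAt) (fun r hr => (hd r hr).deriv)

theorem exists_eq_expSol_combination {l : ℕ} (hl : l = 1 ∨ l = 2) {κ : ℂ} (hκ : κ ≠ 0)
    {u u' : ℝ → ℂ} (hu : ∀ r ∈ Ioi (0 : ℝ), HasDerivAt u (u' r) r)
    (hu' : ∀ r ∈ Ioi (0 : ℝ),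
      HasDerivAt u' ((l * (l + 1) / (r : ℂ) ^ 2 + κ ^ 2) * u r) r) :
    ∃ a b : ℂ, ∀ r ∈ Ioi (0 : ℝ), u r = a * expSol l κ r + b * expSol l (-κ) r := by
  obtain ⟨a, ha⟩ := wronskian_const hu hu'
    (fun r hr => hasDerivAt_expSol hl κ (ne_of_gt hr))
    (fun r hr => hasDerivAt_expSolDeriv hl κ (ne_of_gt hr))
  obtain ⟨b, hb⟩ := wronskian_const (q := fun r => l * (l + 1) / (r : ℂ) ^ 2 + κ ^ 2) hu hu'
    (fun r hr => hasDerivAt_expSol hl (-κ) (ne_of_gt hr))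
    (fun r hr => by simpa using hasDerivAt_expSolDeriv hl (-κ) (ne_of_gt hr))
  obtain ⟨w, hw, hW⟩ : ∃ w : ℂ, w ≠ 0 ∧ ∀ r ∈ Ioi (0 : ℝ),
      expSol l κ r * expSolDeriv l (-κ) r - expSolDeriv l κ r * expSol l (-κ) r = w := by
    have he : ∀ r : ℝ, Complex.exp (κ * r) * Complex.exp (-κ * r) = 1 := fun r => by
      rw [← Complex.exp_add]; simp
    rcases hl with rfl | rfl
    · refine ⟨2 * κ ^ 3, by simpa using hκ, fun r hr => ?_⟩
      simp only [expSol, expSolDeriv, expSolCoeff, if_true]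
      linear_combination (2 * κ ^ 3) * he r
    · refine ⟨-2 * κ ^ 5, by simpa using hκ, fun r hr => ?_⟩
      simp only [expSol, expSolDeriv, expSolCoeff, OfNat.ofNat_ne_one, if_false]
      linear_combination (-2 * κ ^ 5) * he r
  refine ⟨b / w, -a / w, fun r hr => ?_⟩
  rw [← ha r hr, ← hb r hr]
  field_simp
  rw [← hW r hr]
  ring

theorem not_tendsto_norm_atTop_of_integrableOn {f : ℝ → ℂ}
    (hf : IntegrableOn (fun r => ‖f r‖ ^ 2) (Ioi 0)) : ¬ Tendsto (fun r => ‖f r‖) atTop atTop := by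
  intro h
  obtain ⟨R, hR⟩ := (eventually_atTop.1 (h.eventually_ge_atTop 1))
  have h1 : IntegrableOn (fun _ : ℝ => (1 : ℝ)) (Ioi (max R 0)) := by
    refine Integrable.mono' (hf.mono_set (Ioi_subset_Ioi (le_max_right R 0)))
      (by fun_prop) ?_
    filter_upwards [self_mem_ae_restrict measurableSet_Ioi] with r hr
    have := hR r ((le_max_left R 0).trans (le_of_lt hr))
    simpa using one_le_pow₀ (n := 2) this
  simp [integrableOn_const_iff] at h1

theorem eq_zero_of_integrableOn_of_tendsto_mul {l : ℕ} (hl : 1 ≤ l) {f : ℝ → ℂ} {c : ℂ}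
    (hf : IntegrableOn (fun r => ‖f r‖ ^ 2) (Ioi 0))
    (h : Tendsto (fun r : ℝ => (r : ℂ) ^ l * f r) (𝓝[>] 0) (𝓝 c)) : c = 0 := by
  by_contra hc
  have hc' : 0 < ‖c‖ := norm_pos_iff.2 hc
  have hev := h.norm.eventually (eventually_gt_nhds (half_lt_self hc'))
  obtain ⟨ε, hε, hε'⟩ := mem_nhdsGT_iff_exists_Ioo_subset.1 hev
  have hε : (0 : ℝ) < ε := hε
  have hδ : 0 < min ε 1 := lt_min hε one_pos
  have h1 : IntegrableOn (fun r : ℝ => r ^ (-1 : ℝ)) (Ioo 0 (min ε 1)) := by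
    refine Integrable.mono' ((hf.mono_set Ioo_subset_Ioi_self).const_mul ((‖c‖ / 2) ^ 2)⁻¹)
      (by fun_prop) ?_
    filter_upwards [self_mem_ae_restrict measurableSet_Ioo] with r hr
    have hr0 : 0 < r := hr.1
    have hr1 : r ≤ 1 := hr.2.le.trans (min_le_right _ _)
    have h2 : ‖c‖ / 2 < ‖(r : ℂ) ^ l * f r‖ := hε' ⟨hr0, hr.2.trans_le (min_le_left _ _)⟩
    rw [norm_mul, norm_pow, Complex.norm_real, Real.norm_of_nonneg hr0.le] at h2
    have h3 : ‖c‖ / 2 ≤ r * ‖f r‖ := h2.le.trans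
      (mul_le_mul_of_nonneg_right (pow_le_of_le_one hr0.le hr1 (by omega)) (norm_nonneg _))
    have h4 : (‖c‖ / 2) ^ 2 ≤ r * ‖f r‖ ^ 2 := by
      calc (‖c‖ / 2) ^ 2 ≤ (r * ‖f r‖) ^ 2 := by gcongr
        _ = r * (r * ‖f r‖ ^ 2) := by ring
        _ ≤ 1 * (r * ‖f r‖ ^ 2) := by gcongr
        _ = _ := one_mul _
    rw [Real.rpow_neg_one, Real.norm_of_nonneg (inv_nonneg.2 hr0.le), inv_mul_eq_div,
      le_div_iff₀ (by positivity), inv_mul_le_iff₀ hr0]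
    exact h4
  rw [intervalIntegral.integrableOn_Ioo_rpow_iff hδ] at h1
  exact lt_irrefl _ h1

theorem tendsto_expSolCoeff_inv_atTop {l : ℕ} (hl : l = 1 ∨ l = 2) (κ : ℂ) :
    Tendsto (fun r : ℝ => expSolCoeff l κ (r : ℂ)⁻¹) atTop (𝓝 (κ ^ l)) := by
  have hi : Tendsto (fun r : ℝ => (r : ℂ)⁻¹) atTop (𝓝 0) := by
    have := (Complex.continuous_ofReal.tendsto 0).comp tendsto_inv_atTop_zero
    simpa [Function.comp_def] using this
  rcases hl with rfl | rfl
  · simpa [expSolCoeff] using hi.const_sub κ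
  · simpa [expSolCoeff] using
      ((hi.const_mul (3 * κ)).const_sub (κ ^ 2)).add ((hi.pow 2).const_mul 3)

theorem tendsto_exp_neg_mul_expSol {l : ℕ} (hl : l = 1 ∨ l = 2) (κ : ℂ) :
    Tendsto (fun r : ℝ => Complex.exp (-(κ * r)) * expSol l κ r) atTop (𝓝 (κ ^ l)) := by
  refine (tendsto_expSolCoeff_inv_atTop hl κ).congr fun r => ?_
  rw [expSol, ← mul_assoc, ← Complex.exp_add]
  simp

theorem tendsto_exp_neg_mul_expSol_zero {l : ℕ} (hl : l = 1 ∨ l = 2) {κ μ : ℂ}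
    (h : κ.re < μ.re) :
    Tendsto (fun r : ℝ => Complex.exp (-(μ * r)) * expSol l κ r) atTop (𝓝 0) := by
  have he : Tendsto (fun r : ℝ => Complex.exp ((κ - μ) * r)) atTop (𝓝 0) := by
    rw [Complex.tendsto_exp_nhds_zero_iff]
    simpa using tendsto_id.const_mul_atTop_of_neg (sub_neg.2 h)
  have := he.mul (tendsto_expSolCoeff_inv_atTop hl κ)
  rw [zero_mul] at this
  refine this.congr fun r => ?_
  rw [expSol, ← mul_assoc, ← Complex.exp_add]
  ring_nf

theorem tendsto_pow_mul_expSol {l : ℕ} (hl : l = 1 ∨ l = 2) (κ : ℂ) :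
    Tendsto (fun r : ℝ => (r : ℂ) ^ l * expSol l κ r) (𝓝[>] 0)
      (𝓝 (if l = 1 then -1 else 3)) := by
  rcases hl with rfl | rfl
  · have hc : Continuous fun r : ℝ => Complex.exp (κ * r) * (r * κ - 1) := by fun_prop
    have := (hc.tendsto 0).mono_left (nhdsWithin_le_nhds (s := Ioi 0))
    simp only [Complex.ofReal_zero, mul_zero, Complex.exp_zero, zero_mul, zero_sub, one_mul] at this
    simp only [if_true]
    refine this.congr' ?_
    filter_upwards [self_mem_nhdsWithin] with r hr
    have : (r : ℂ) ≠ 0 := Complex.ofReal_ne_zero.2 (ne_of_gt hr)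
    simp only [expSol, expSolCoeff, if_true]
    field_simp
  · have hc : Continuous fun r : ℝ =>
        Complex.exp (κ * r) * (r ^ 2 * κ ^ 2 - 3 * κ * r + 3) := by fun_prop
    have := (hc.tendsto 0).mono_left (nhdsWithin_le_nhds (s := Ioi 0))
    simp only [Complex.ofReal_zero, mul_zero, Complex.exp_zero, ne_eq, OfNat.ofNat_ne_zero,
      not_false_eq_true, zero_pow, zero_mul, sub_zero, zero_add, one_mul] at this
    simp only [OfNat.ofNat_ne_one, if_false]
    refine this.congr' ?_
    filter_upwards [self_mem_nhdsWithin] with r hr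
    have : (r : ℂ) ≠ 0 := Complex.ofReal_ne_zero.2 (ne_of_gt hr)
    simp only [expSol, expSolCoeff, OfNat.ofNat_ne_one, if_false]
    field_simp

theorem eq_zero_of_integrableOn_of_tendsto_exp_mul {f : ℝ → ℂ} {κ c : ℂ} (hκ : 0 < κ.re)
    (hf : IntegrableOn (fun r => ‖f r‖ ^ 2) (Ioi 0))
    (h : Tendsto (fun r : ℝ => Complex.exp (-(κ * r)) * f r) atTop (𝓝 c)) : c = 0 := by
  by_contra hc
  refine not_tendsto_norm_atTop_of_integrableOn hf ?_
  have he : Tendsto (fun r : ℝ => ‖Complex.exp (κ * r)‖) atTop atTop := by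
    simp only [Complex.norm_exp, Complex.re_mul_ofReal]
    exact Real.tendsto_exp_atTop.comp (tendsto_id.const_mul_atTop hκ)
  refine (he.atTop_mul_pos (norm_pos_iff.2 hc) h.norm).congr fun r => ?_
  rw [← norm_mul, ← mul_assoc, ← Complex.exp_add]
  simp

theorem exists_Tl_sub_eq_expSol_combination {l : ℕ} (hl : l = 1 ∨ l = 2) {κ μ : ℂ} (hκ : κ ≠ 0)
    (hμ : κ ^ 4 = μ) {g : ℝ → ℂ}
    (hg1 : ∀ r ∈ Ioi (0 : ℝ), DifferentiableAt ℝ g r)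
    (hg2 : ∀ r ∈ Ioi (0 : ℝ), DifferentiableAt ℝ (deriv g) r)
    (hg3 : ∀ r ∈ Ioi (0 : ℝ), DifferentiableAt ℝ (deriv (deriv g)) r)
    (hg4 : ∀ r ∈ Ioi (0 : ℝ), DifferentiableAt ℝ (deriv (deriv (deriv g))) r)
    (heq : ∀ r ∈ Ioi (0 : ℝ), Tl l (Tl l g) r = μ * g r) :
    ∃ a b : ℂ, ∀ r ∈ Ioi (0 : ℝ),
      Tl l g r - κ ^ 2 * g r = a * expSol l κ r + b * expSol l (-κ) r := by
  have hG : ∀ r ∈ Ioi (0 : ℝ), HasDerivAt (Tl l g) (-(deriv (deriv (deriv g)) r) +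
      (l * (l + 1)) * (deriv g r * (r : ℂ)⁻¹ ^ 2 - 2 * g r * (r : ℂ)⁻¹ ^ 3)) r := by
    intro r hr
    have hi := (hasDerivAt_ofReal_inv (ne_of_gt hr)).pow 2
    refine ((hg3 r hr).hasDerivAt.neg.add
      (((hg1 r hr).hasDerivAt.mul hi).const_mul ((l : ℂ) * (l + 1)))).congr_deriv ?_
      |>.congr_of_eventuallyEq (.of_forall fun s => ?_)
    · simp; left; ring
    · simp [Tl]; ring
  have hG' : ∀ r ∈ Ioi (0 : ℝ), DifferentiableAt ℝ (deriv (Tl l g)) r := by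
    intro r hr
    have hev : deriv (Tl l g) =ᶠ[𝓝 r] fun r => -(deriv (deriv (deriv g)) r) +
        (l * (l + 1)) * (deriv g r * (r : ℂ)⁻¹ ^ 2 - 2 * g r * (r : ℂ)⁻¹ ^ 3) := by
      filter_upwards [Ioi_mem_nhds hr] with s hs using (hG s hs).deriv
    have hi := (hasDerivAt_ofReal_inv (ne_of_gt hr)).differentiableAt
    refine DifferentiableAt.congr_of_eventuallyEq ?_ hev
    exact (hg4 r hr).neg.add ((((hg2 r hr).mul (hi.pow 2)).sub
      (((hg1 r hr).const_mul 2).mul (hi.pow 3))).const_mul _)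
  refine exists_eq_expSol_combination hl hκ
    (u' := fun r => deriv (Tl l g) r - κ ^ 2 * deriv g r) (fun r hr => ?_) (fun r hr => ?_)
  · exact (hG r hr).differentiableAt.hasDerivAt.sub ((hg1 r hr).hasDerivAt.const_mul _)
  · refine ((hG' r hr).hasDerivAt.sub ((hg2 r hr).hasDerivAt.const_mul _)).congr_deriv ?_
    have h1 : Tl l g r = -(deriv (deriv g) r) + (l * (l + 1)) * g r / (r : ℂ) ^ 2 := rfl
    have h2 : -(deriv (deriv (Tl l g)) r) + (l * (l + 1)) * Tl l g r / (r : ℂ) ^ 2 = μ * g r :=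
      heq r hr
    linear_combination -h2 - κ ^ 2 * h1 + g r * hμ

theorem Dop_one_apply {w w' : ℝ → ℂ} (hw : ∀ s ∈ Ioi (0 : ℝ), HasDerivAt w (w' s) s)
    {r : ℝ} (hr : r ∈ Ioi (0 : ℝ)) : Dop 1 w r = w' r - w r * (r : ℂ)⁻¹ := by
  have hr0 : (r : ℂ) ≠ 0 := Complex.ofReal_ne_zero.2 (ne_of_gt hr)
  have h := (hw r hr).mul (hasDerivAt_ofReal_inv (ne_of_gt hr))
  simp only [Dop, Function.iterate_one, div_eq_mul_inv]
  rw [show deriv (fun s : ℝ => w s * (s : ℂ)⁻¹) r = _ from h.deriv]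
  field_simp
  ring

theorem Dop_two_apply {w w' w'' : ℝ → ℂ} (hw : ∀ s ∈ Ioi (0 : ℝ), HasDerivAt w (w' s) s)
    (hw' : ∀ s ∈ Ioi (0 : ℝ), HasDerivAt w' (w'' s) s) {r : ℝ} (hr : r ∈ Ioi (0 : ℝ)) :
    Dop 2 w r = w'' r - 3 * w' r * (r : ℂ)⁻¹ + 3 * w r * (r : ℂ)⁻¹ ^ 2 := by
  have hr0 : (r : ℂ) ≠ 0 := Complex.ofReal_ne_zero.2 (ne_of_gt hr)
  have hi := hasDerivAt_ofReal_inv (ne_of_gt hr)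
  have hev : (fun s : ℝ => (s : ℂ)⁻¹ * deriv (fun s : ℝ => w s * (s : ℂ)⁻¹) s) =ᶠ[𝓝 r]
      fun s => w' s * (s : ℂ)⁻¹ ^ 2 - w s * (s : ℂ)⁻¹ ^ 3 := by
    filter_upwards [Ioi_mem_nhds hr] with s hs
    rw [show deriv (fun s : ℝ => w s * (s : ℂ)⁻¹) s = _ from
      ((hw s hs).mul (hasDerivAt_ofReal_inv (ne_of_gt hs))).deriv]
    ring
  have h := ((hw' r hr).mul (hi.pow 2)).sub ((hw r hr).mul (hi.pow 3))
  simp only [Dop, Function.iterate_succ, Function.iterate_zero, Function.comp_apply, id_eq,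
    div_eq_mul_inv]
  rw [hev.deriv_eq,
    show deriv (fun s : ℝ => w' s * (s : ℂ)⁻¹ ^ 2 - w s * (s : ℂ)⁻¹ ^ 3) r = _ from h.deriv]
  simp
  field_simp
  ring

theorem Dop_exp_sub_exp {l : ℕ} (hl : l = 1 ∨ l = 2) (κ ν : ℂ) {r : ℝ} (hr : r ∈ Ioi (0 : ℝ)) :
    Dop l (fun s : ℝ => Complex.exp (κ * s) - Complex.exp (ν * s)) r =
      expSol l κ r - expSol l ν r := by
  have h1 : ∀ s ∈ Ioi (0 : ℝ), HasDerivAt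
      (fun s : ℝ => Complex.exp (κ * s) - Complex.exp (ν * s))
      (κ * Complex.exp (κ * s) - ν * Complex.exp (ν * s)) s := fun s _ =>
    (hasDerivAt_cexp_mul_ofReal κ s).sub (hasDerivAt_cexp_mul_ofReal ν s)
  have h2 : ∀ s ∈ Ioi (0 : ℝ), HasDerivAt
      (fun s : ℝ => κ * Complex.exp (κ * s) - ν * Complex.exp (ν * s))
      (κ * (κ * Complex.exp (κ * s)) - ν * (ν * Complex.exp (ν * s))) s := fun s _ =>
    ((hasDerivAt_cexp_mul_ofReal κ s).const_mul κ).sub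
      ((hasDerivAt_cexp_mul_ofReal ν s).const_mul ν)
  rcases hl with rfl | rfl
  · rw [Dop_one_apply h1 hr]
    simp only [expSol, expSolCoeff, if_true]
    ring
  · rw [Dop_two_apply h1 h2 hr]
    simp only [expSol, expSolCoeff, OfNat.ofNat_ne_one, if_false]
    ring

theorem exists_eq_mul_sub_of_integrableOn {l : ℕ} (hl : l = 1 ∨ l = 2) {κ ν : ℂ}
    (hκ : κ.re < 0) (hνκ : ν.re < κ.re) {g : ℝ → ℂ} {a a' b b' : ℂ}
    (hg : ∀ r ∈ Ioi (0 : ℝ), g r = a * expSol l κ r + a' * expSol l (-κ) r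
      + (b * expSol l ν r + b' * expSol l (-ν) r))
    (hL2 : IntegrableOn (fun r => ‖g r‖ ^ 2) (Ioi 0)) :
    ∀ r ∈ Ioi (0 : ℝ), g r = a * (expSol l κ r - expSol l ν r) := by
  have hne : ∀ {z : ℂ}, z.re < 0 → (-z) ^ l ≠ 0 := fun {z} hz =>
    pow_ne_zero _ (neg_ne_zero.2 fun h => by simp [h] at hz)
  have hb' : b' = 0 := by
    have h := ((((tendsto_exp_neg_mul_expSol_zero hl (κ := κ) (μ := -ν)
      (by simp; linarith)).const_mul a).add
      ((tendsto_exp_neg_mul_expSol_zero hl (κ := -κ) (μ := -ν)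
      (by simp; linarith)).const_mul a')).add
      ((tendsto_exp_neg_mul_expSol_zero hl (κ := ν) (μ := -ν)
      (by simp; linarith)).const_mul b)).add ((tendsto_exp_neg_mul_expSol hl (-ν)).const_mul b')
    have h0 := eq_zero_of_integrableOn_of_tendsto_exp_mul (κ := -ν) (by simp; linarith) hL2
      (h.congr' (by
        filter_upwards [Ioi_mem_atTop 0] with r hr
        rw [hg r hr]; ring))
    simpa [hne (hνκ.trans hκ)] using h0
  have ha' : a' = 0 := by
    have h := ((((tendsto_exp_neg_mul_expSol_zero hl (κ := κ) (μ := -κ)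
      (by simp; linarith)).const_mul a).add
      ((tendsto_exp_neg_mul_expSol_zero hl (κ := ν) (μ := -κ)
      (by simp; linarith)).const_mul b))).add ((tendsto_exp_neg_mul_expSol hl (-κ)).const_mul a')
    have h0 := eq_zero_of_integrableOn_of_tendsto_exp_mul (κ := -κ) (by simp; linarith) hL2
      (h.congr' (by
        filter_upwards [Ioi_mem_atTop 0] with r hr
        rw [hg r hr, hb']; ring))
    simpa [hne hκ] using h0
  have hab : a + b = 0 := by
    have h := ((tendsto_pow_mul_expSol hl κ).const_mul a).add
      ((tendsto_pow_mul_expSol hl ν).const_mul b)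
    have h0 := eq_zero_of_integrableOn_of_tendsto_mul (l := l) (by omega) hL2
      (h.congr' (by
        filter_upwards [self_mem_nhdsWithin] with r hr
        rw [hg r hr, hb', ha']; ring))
    rw [← add_mul] at h0
    refine (mul_eq_zero.1 h0).resolve_right ?_
    split_ifs <;> norm_num
  intro r hr
  rw [hg r hr, ha', hb', eq_neg_of_add_eq_zero_right hab]
  ring

/-- For `l ∈ {1,2}` and `ρ > 0`, any four times differentiable square-integrable
solution of `T_l² g = i ρ⁴ g` on `(0,∞)` is a constant multiple of `g_{l+}`;
the space of such solutions is one-dimensional, so `T_l²` has deficiency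
indices `(1,1)`. -/
theorem stmt6 (l : ℕ) (hl : l = 1 ∨ l = 2) (ρ : ℝ) (hρ : 0 < ρ) (g : ℝ → ℂ)
    (hg1 : ∀ r ∈ Ioi (0 : ℝ), DifferentiableAt ℝ g r)
    (hg2 : ∀ r ∈ Ioi (0 : ℝ), DifferentiableAt ℝ (deriv g) r)
    (hg3 : ∀ r ∈ Ioi (0 : ℝ), DifferentiableAt ℝ (deriv (deriv g)) r)
    (hg4 : ∀ r ∈ Ioi (0 : ℝ), DifferentiableAt ℝ (deriv (deriv (deriv g))) r)
    (heq : ∀ r ∈ Ioi (0 : ℝ), Tl l (Tl l g) r = Complex.I * (ρ : ℂ) ^ 4 * g r)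
    (hL2 : IntegrableOn (fun r => ‖g r‖ ^ 2) (Ioi 0)) :
    ∃ c : ℂ, ∀ r ∈ Ioi (0 : ℝ), g r = c * gPlus l ρ r := by
  set κ : ℂ := Complex.exp (Complex.I * (5 * Real.pi / 8)) * ρ with hκdef
  set ν : ℂ := Complex.exp (Complex.I * (9 * Real.pi / 8)) * ρ with hνdef
  have hρ0 : (ρ : ℂ) ≠ 0 := Complex.ofReal_ne_zero.2 hρ.ne'
  have hκ0 : κ ≠ 0 := mul_ne_zero (Complex.exp_ne_zero _) hρ0
  have hν0 : ν ≠ 0 := mul_ne_zero (Complex.exp_ne_zero _) hρ0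
  have hνκ2 : ν ^ 2 = -κ ^ 2 := by
    rw [hνdef, hκdef, mul_pow, mul_pow, ← Complex.exp_nat_mul, ← Complex.exp_nat_mul,
      show ((2 : ℕ) : ℂ) * (Complex.I * (9 * Real.pi / 8)) =
        (2 : ℕ) * (Complex.I * (5 * Real.pi / 8)) + Real.pi * Complex.I by push_cast; ring,
      Complex.exp_add, Complex.exp_pi_mul_I]
    ring
  have hκ4 : κ ^ 4 = Complex.I * (ρ : ℂ) ^ 4 := by
    rw [hκdef, mul_pow, ← Complex.exp_nat_mul,
      show ((4 : ℕ) : ℂ) * (Complex.I * (5 * Real.pi / 8)) =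
        Real.pi / 2 * Complex.I + 2 * Real.pi * Complex.I by push_cast; ring,
      Complex.exp_add, Complex.exp_two_pi_mul_I, Complex.exp_pi_div_two_mul_I, mul_one]
  have hν4 : ν ^ 4 = Complex.I * (ρ : ℂ) ^ 4 := by
    rw [← hκ4]
    linear_combination (ν ^ 2 - κ ^ 2) * hνκ2
  have hκre : κ.re = Real.cos (5 * Real.pi / 8) * ρ := by
    rw [hκdef, Complex.re_mul_ofReal, show Complex.I * (5 * Real.pi / 8) =
      ((5 * Real.pi / 8 : ℝ) : ℂ) * Complex.I by push_cast; ring, Complex.exp_ofReal_mul_I_re]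
  have hνre : ν.re = Real.cos (7 * Real.pi / 8) * ρ := by
    rw [hνdef, Complex.re_mul_ofReal, show Complex.I * (9 * Real.pi / 8) =
      ((9 * Real.pi / 8 : ℝ) : ℂ) * Complex.I by push_cast; ring, Complex.exp_ofReal_mul_I_re,
      ← Real.cos_two_pi_sub (9 * Real.pi / 8)]
    ring_nf
  have hπ := Real.pi_pos
  have hκneg : κ.re < 0 := by
    rw [hκre]
    exact mul_neg_of_neg_of_pos
      (Real.cos_neg_of_pi_div_two_lt_of_lt (by linarith) (by linarith)) hρ
  have hνκ : ν.re < κ.re := by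
    rw [hκre, hνre]
    exact mul_lt_mul_of_pos_right
      (Real.cos_lt_cos_of_nonneg_of_le_pi (by linarith) (by linarith) (by linarith)) hρ
  obtain ⟨a, a', ha⟩ := exists_Tl_sub_eq_expSol_combination hl hκ0 hκ4 hg1 hg2 hg3 hg4 heq
  obtain ⟨b, b', hb⟩ := exists_Tl_sub_eq_expSol_combination hl hν0 hν4 hg1 hg2 hg3 hg4 heq
  have hm : -2 * κ ^ 2 ≠ 0 := by simpa using hκ0
  have hcomb : ∀ r ∈ Ioi (0 : ℝ), g r =
      a / (-2 * κ ^ 2) * expSol l κ r + a' / (-2 * κ ^ 2) * expSol l (-κ) r +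
        (-b / (-2 * κ ^ 2) * expSol l ν r + -b' / (-2 * κ ^ 2) * expSol l (-ν) r) := by
    intro r hr
    have h : -2 * κ ^ 2 * g r = a * expSol l κ r + a' * expSol l (-κ) r +
        (-b * expSol l ν r + -b' * expSol l (-ν) r) := by
      linear_combination ha r hr - hb r hr - g r * hνκ2
    refine mul_left_cancel₀ hm (h.trans ?_)
    field_simp
    ring
  refine ⟨a / (-2 * κ ^ 2), fun r hr => ?_⟩
  rw [exists_eq_mul_sub_of_integrableOn hl hκneg hνκ hcomb hL2 r hr]
  exact congrArg _ (Dop_exp_sub_exp hl κ ν hr).symm
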